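/- Let f^{(ε,ϑ)}(z, z̄) = ⟨K_{ε,ϑ}(z,·), K_{ε,ϑ}(z̄,·)⟩_{L²(ℝ⁴)} be the covariance kernel of K * ξ_{ε,ϑ}, where K is a kernel of parabolic order −3 supported in the unit parabolic ball, ξ_{ε,ϑ} is the piecewise-linear-in-time, ε-mollified white noise, and ε² ≤ C₀ϑ. Then for every δ > 0 there exists C (uniform in ε, ϑ) such that |f^{(ε,ϑ)}(z, z̄)| ≤ C ‖z − z̄‖_s^{-1-δ} for all z ≠ z̄. -/

import Mathlib

open MeasureTheory

/-- The parabolic norm on `ℝ × ℝ³` with scaling `(2,1,1,1)`. -/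
noncomputable def pnorm (z : ℝ × EuclideanSpace ℝ (Fin 3)) : ℝ :=
  |z.1| ^ ((1 : ℝ) / 2) + ‖z.2‖

/-- The kernel `K_{ε,ϑ}(z, z₂)` representing `(K * ξ_{ε,ϑ})(z) = ∫ K_{ε,ϑ}(z, z₂) ξ(z₂) dz₂`,
where `ξ_{ε,ϑ}` is the noise mollified at scale `ε` (with the product mollifier
`ρ_ε(t,x) = ε⁻⁵ ρ₁(t/ε²) ρ₂(x/ε)`) and then block-averaged in time on the grid `ϑ·ℤ`. -/
noncomputable def Kem (K : ℝ × EuclideanSpace ℝ (Fin 3) → ℝ) (ρ₁ : ℝ → ℝ)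
    (ρ₂ : EuclideanSpace ℝ (Fin 3) → ℝ) (ε ϑ : ℝ)
    (z z₂ : ℝ × EuclideanSpace ℝ (Fin 3)) : ℝ :=
  ∫ u : ℝ, ∫ y₁ : EuclideanSpace ℝ (Fin 3),
    K (z.1 - u, z.2 - y₁) *
      ((1 / ϑ) * ∫ u₁ in ((⌊u / ϑ⌋ : ℝ) * ϑ)..(((⌊u / ϑ⌋ : ℝ) + 1) * ϑ),
        (ε ^ (-2 : ℝ) * ρ₁ ((u₁ - z₂.1) / ε ^ 2)) * (ε ^ (-3 : ℝ) * ρ₂ (ε⁻¹ • (y₁ - z₂.2))))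

/-- The covariance kernel `f^{(ε,ϑ)}(z, z̄) = ⟨K_{ε,ϑ}(z,·), K_{ε,ϑ}(z̄,·)⟩_{L²(ℝ⁴)}`. -/
noncomputable def fcov (K : ℝ × EuclideanSpace ℝ (Fin 3) → ℝ) (ρ₁ : ℝ → ℝ)
    (ρ₂ : EuclideanSpace ℝ (Fin 3) → ℝ) (ε ϑ : ℝ)
    (z zb : ℝ × EuclideanSpace ℝ (Fin 3)) : ℝ :=
  ∫ z₁ : ℝ × EuclideanSpace ℝ (Fin 3), Kem K ρ₁ ρ₂ ε ϑ z z₁ * Kem K ρ₁ ρ₂ ε ϑ zb z₁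

open scoped ENNReal

lemma ENNReal.inv_le_two_mul_inv {x y : ℝ≥0∞} (h : x ≤ 2 * y) : y⁻¹ ≤ 2 * x⁻¹ := by
  have h' := ENNReal.inv_le_inv.2 h
  rw [ENNReal.mul_inv (by simp) (by simp)] at h'
  calc y⁻¹ = 2 * (2⁻¹ * y⁻¹) := by
        rw [← mul_assoc, ENNReal.mul_inv_cancel (by simp) (by simp), one_mul]
    _ ≤ _ := by gcongr

section TruncatedSingularity

variable {E : Type*} [NormedAddCommGroup E]

/-- The singularity `‖x‖⁻ᵃ`, truncated to the closed ball of radius `R`. -/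
noncomputable def truncSing (R a : ℝ) (x : E) : ℝ≥0∞ :=
  (Metric.closedBall (0 : E) R).indicator (fun x => (‖x‖ₑ⁻¹) ^ a) x

lemma truncSing_of_norm_le {R : ℝ} (a : ℝ) {x : E} (hx : ‖x‖ ≤ R) :
    truncSing R a x = (‖x‖ₑ⁻¹) ^ a :=
  Set.indicator_of_mem (by simpa using hx) _

lemma truncSing_of_lt_norm {R : ℝ} (a : ℝ) {x : E} (hx : R < ‖x‖) :
    truncSing R a x = 0 :=
  Set.indicator_of_notMem (by simpa using hx) _

lemma truncSing_le (R a : ℝ) (x : E) : truncSing R a x ≤ (‖x‖ₑ⁻¹) ^ a :=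
  Set.indicator_le_self _ _ _

/-- A product of two singularities is controlled by a sum of weaker ones, at the price of
a singularity in the distance of the two poles. -/
lemma truncSing_mul_le {R a p q : ℝ} (hR : 1 ≤ R) (hp : 0 ≤ p) (hpa : p ≤ a) (hpq : p ≤ q)
    (u v : E) :
    truncSing R a u * truncSing R a v ≤
      (ENNReal.ofReal R ^ (q - p) * 2 ^ q) * (‖u - v‖ₑ⁻¹) ^ q *
        (truncSing R (2 * a - p) u + truncSing R (2 * a - p) v) := by
  wlog huv : ‖u‖ₑ ≤ ‖v‖ₑ generalizing u v
  · have h := this v u (le_of_not_ge huv)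
    rwa [mul_comm (truncSing R a v), add_comm (truncSing R _ v), enorm_sub_rev] at h
  rcases lt_or_ge R ‖u‖ with hu | hu
  · simp [truncSing_of_lt_norm a hu]
  rcases lt_or_ge R ‖v‖ with hv | hv
  · simp [truncSing_of_lt_norm a hv]
  refine le_trans ?_ (mul_le_mul_right (le_self_add) _)
  rw [truncSing_of_norm_le _ hu, truncSing_of_norm_le _ hu, truncSing_of_norm_le _ hv]
  have hvR : ‖v‖ₑ ≤ ENNReal.ofReal R := by
    rw [← ofReal_norm]; exact ENNReal.ofReal_le_ofReal hv
  have hD : ‖v‖ₑ⁻¹ ≤ 2 * ‖u - v‖ₑ⁻¹ := by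
    refine ENNReal.inv_le_two_mul_inv ?_
    calc ‖u - v‖ₑ ≤ ‖u‖ₑ + ‖v‖ₑ := enorm_sub_le
      _ ≤ ‖v‖ₑ + ‖v‖ₑ := by gcongr
      _ = 2 * ‖v‖ₑ := by ring
  have hinv : ‖v‖ₑ⁻¹ ^ p ≤ ENNReal.ofReal R ^ (q - p) * (‖v‖ₑ⁻¹) ^ q := by
    have hq : (‖v‖ₑ⁻¹) ^ q = (‖v‖ₑ⁻¹) ^ (q - p) * (‖v‖ₑ⁻¹) ^ p := by
      rw [← ENNReal.rpow_add_of_nonneg _ _ (by linarith) hp]; congr 1; ring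
    have h1 : 1 ≤ ENNReal.ofReal R ^ (q - p) * (‖v‖ₑ⁻¹) ^ (q - p) := by
      rw [← ENNReal.mul_rpow_of_nonneg _ _ (by linarith)]
      have : 1 ≤ ENNReal.ofReal R * ‖v‖ₑ⁻¹ := by
        have h0 : ENNReal.ofReal R ≠ 0 := by simp; linarith
        calc 1 = ENNReal.ofReal R * (ENNReal.ofReal R)⁻¹ :=
              (ENNReal.mul_inv_cancel h0 ENNReal.ofReal_ne_top).symm
          _ ≤ _ := by gcongr
      simpa using ENNReal.rpow_le_rpow this (by linarith : 0 ≤ q - p)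
    rw [hq, ← mul_assoc]
    calc _ = 1 * ‖v‖ₑ⁻¹ ^ p := (one_mul _).symm
      _ ≤ _ := by gcongr
  calc (‖u‖ₑ⁻¹) ^ a * (‖v‖ₑ⁻¹) ^ a
      = (‖u‖ₑ⁻¹) ^ a * ((‖v‖ₑ⁻¹) ^ (a - p) * (‖v‖ₑ⁻¹) ^ p) := by
        rw [← ENNReal.rpow_add_of_nonneg _ _ (by linarith) hp]; congr 2; ring
    _ ≤ (‖u‖ₑ⁻¹) ^ a * ((‖u‖ₑ⁻¹) ^ (a - p) *
          (ENNReal.ofReal R ^ (q - p) * (2 * ‖u - v‖ₑ⁻¹) ^ q)) := by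
        have h2 := ENNReal.rpow_le_rpow hD (hp.trans hpq)
        refine mul_le_mul_right (mul_le_mul' ?_ (hinv.trans (by gcongr))) _
        exact ENNReal.rpow_le_rpow (ENNReal.inv_le_inv.2 huv) (by linarith)
    _ = (ENNReal.ofReal R ^ (q - p) * 2 ^ q) * (‖u - v‖ₑ⁻¹) ^ q *
          ((‖u‖ₑ⁻¹) ^ a * (‖u‖ₑ⁻¹) ^ (a - p)) := by
        rw [ENNReal.mul_rpow_of_nonneg _ _ (by linarith)]; ring
    _ = _ := by
        rw [← ENNReal.rpow_add_of_nonneg _ _ (by linarith) (by linarith)]; congr 2; ring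

variable [MeasurableSpace E] [BorelSpace E]

@[fun_prop]
lemma measurable_truncSing (R a : ℝ) : Measurable (truncSing R a : E → ℝ≥0∞) := by
  unfold truncSing
  exact Measurable.indicator (by fun_prop) Metric.isClosed_closedBall.measurableSet

variable [NormedSpace ℝ E] [FiniteDimensional ℝ E]
  (μ : Measure E) [μ.IsAddHaarMeasure]

lemma lintegral_truncSing_lt_top [Nontrivial E] {a : ℝ} (R : ℝ) (ha : a < Module.finrank ℝ E) :
    ∫⁻ x, truncSing R a x ∂μ < ∞ := by
  have hd : 1 ≤ Module.finrank ℝ E := Module.finrank_pos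
  have hint : IntegrableOn (fun x : E => ‖x‖ ^ (-a)) (Metric.ball 0 (R + 1)) μ :=
    integrableOn_ball_of_norm_le_rpow (C := 1) hd ha
      (.of_forall fun x => by simp [abs_of_nonneg (Real.rpow_nonneg (norm_nonneg x) _)])
      (Measurable.aestronglyMeasurable (by fun_prop))
  refine lt_of_le_of_lt ?_ hint.hasFiniteIntegral
  rw [← lintegral_indicator Metric.isOpen_ball.measurableSet]
  have h0 : ∀ᵐ x ∂μ, x ≠ 0 := by simp [ae_iff]
  refine lintegral_mono_ae ?_
  filter_upwards [h0] with x hx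
  rcases lt_or_ge R ‖x‖ with hxR | hxR
  · simp [truncSing_of_lt_norm a hxR]
  · rw [truncSing_of_norm_le a hxR, Set.indicator_of_mem (by simp; linarith)]
    have hx' : 0 < ‖x‖ := norm_pos_iff.2 hx
    rw [Real.enorm_of_nonneg (by positivity), ← ENNReal.ofReal_rpow_of_pos hx',
      ENNReal.rpow_neg, ENNReal.inv_rpow, ofReal_norm]

/-- The truncated singularity scales like `r ^ (d - a)`. -/
lemma lintegral_truncSing_eq {a r : ℝ} (hr : 0 < r) (ha : 0 ≤ a) :
    ∫⁻ x, truncSing r a x ∂μ =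
      ENNReal.ofReal (r ^ Module.finrank ℝ E) * ((ENNReal.ofReal r)⁻¹) ^ a *
        ∫⁻ x : E, truncSing 1 a x ∂μ := by
  have hscale : ∀ x : E, truncSing 1 a x = ENNReal.ofReal r ^ a * truncSing r a (r • x) := by
    intro x
    have hn : ‖r • x‖ = r * ‖x‖ := by rw [norm_smul, Real.norm_of_nonneg hr.le]
    rcases lt_or_ge 1 ‖x‖ with hx | hx
    · rw [truncSing_of_lt_norm a hx, truncSing_of_lt_norm a (by rw [hn]; nlinarith), mul_zero]
    · rw [truncSing_of_norm_le a hx, truncSing_of_norm_le a (by rw [hn]; nlinarith),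
        ← ENNReal.mul_rpow_of_nonneg _ _ ha, enorm_smul, Real.enorm_of_nonneg hr.le,
        ENNReal.mul_inv (by simp [hr]) (by simp), ← mul_assoc,
        ENNReal.mul_inv_cancel (by simp [hr]) (by simp), one_mul]
  have hmap : ∫⁻ x : E, truncSing r a (r • x) ∂μ =
      ENNReal.ofReal ((r ^ Module.finrank ℝ E)⁻¹) * ∫⁻ x : E, truncSing r a x ∂μ := by
    rw [← lintegral_map (f := truncSing r a) (by fun_prop) (by fun_prop),
      Measure.map_addHaar_smul μ hr.ne', lintegral_smul_measure, abs_of_pos (by positivity),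
      smul_eq_mul]
  have hra : ENNReal.ofReal r ^ a ≠ 0 := by simp [hr, ENNReal.rpow_eq_zero_iff, not_lt]
  have hra' : ENNReal.ofReal r ^ a ≠ ∞ := by simp [ENNReal.rpow_eq_top_iff, ha, not_lt]
  simp_rw [hscale]
  rw [lintegral_const_mul _ (by fun_prop), hmap, ENNReal.inv_rpow,
    ENNReal.ofReal_inv_of_pos (by positivity)]
  have hrd : ENNReal.ofReal (r ^ Module.finrank ℝ E) ≠ 0 := by simp; positivity
  calc _ = (ENNReal.ofReal (r ^ Module.finrank ℝ E) *
        (ENNReal.ofReal (r ^ Module.finrank ℝ E))⁻¹) *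
        ((ENNReal.ofReal r ^ a)⁻¹ * ENNReal.ofReal r ^ a) * ∫⁻ x : E, truncSing r a x ∂μ := by
        rw [ENNReal.mul_inv_cancel hrd (by simp), ENNReal.inv_mul_cancel hra hra', one_mul,
          one_mul]
    _ = _ := by ring

/-- Averaging over balls of radius at most `M` does not worsen the singularity. -/
lemma exists_lintegral_truncSing_sub_le [Nontrivial E] {a : ℝ} (ha : 0 ≤ a) (had : a < Module.finrank ℝ E)
    (M : ℝ) : ∃ C : ℝ≥0∞, C ≠ ∞ ∧ ∀ r : ℝ, 0 < r → r ≤ M → ∀ x : E,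
      ∫⁻ w in Metric.closedBall 0 r, truncSing 1 a (x - w) ∂μ ≤
        C * ENNReal.ofReal (r ^ Module.finrank ℝ E) * truncSing (1 + M) a x := by
  refine ⟨2 ^ a * μ (Metric.ball 0 1) + ENNReal.ofReal (3 ^ Module.finrank ℝ E) *
    ∫⁻ x : E, truncSing 1 a x ∂μ, ?_, fun r hr hrM x => ?_⟩
  · refine ENNReal.add_ne_top.2 ⟨ENNReal.mul_ne_top (by simp)
      measure_ball_lt_top.ne, ENNReal.mul_ne_top (by simp) ?_⟩
    exact (lintegral_truncSing_lt_top μ 1 had).ne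
  have hmeas : MeasurableSet (Metric.closedBall (0 : E) r) :=
    Metric.isClosed_closedBall.measurableSet
  rcases lt_or_ge (1 + M) ‖x‖ with hx | hx
  · refine le_of_eq_of_le ?_ zero_le
    rw [setLIntegral_congr_fun hmeas (g := fun _ => 0), lintegral_zero]
    intro w hw
    have hw' : ‖w‖ ≤ r := by simpa using hw
    exact truncSing_of_lt_norm a (by linarith [norm_sub_norm_le x w])
  rw [truncSing_of_norm_le a hx, add_mul, add_mul]
  rcases le_or_gt (2 * r) ‖x‖ with hxr | hxr
  · refine le_trans ?_ le_self_add
    calc ∫⁻ w in Metric.closedBall 0 r, truncSing 1 a (x - w) ∂μ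
        ≤ ∫⁻ w in Metric.closedBall (0 : E) r, (2 * ‖x‖ₑ⁻¹) ^ a ∂μ := by
          refine setLIntegral_mono' hmeas fun w hw => (truncSing_le _ _ _).trans ?_
          gcongr
          have hw' : ‖w‖ ≤ r := by simpa using hw
          have h1 : ‖x‖ ≤ 2 * ‖x - w‖ := by linarith [norm_sub_norm_le x w]
          refine ENNReal.inv_le_two_mul_inv ?_
          rw [← ofReal_norm, ← ofReal_norm, ← ENNReal.ofReal_ofNat 2,
            ← ENNReal.ofReal_mul (by norm_num)]
          exact ENNReal.ofReal_le_ofReal h1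
      _ = _ := by
          rw [setLIntegral_const, Measure.addHaar_closedBall μ _ hr.le,
            ENNReal.mul_rpow_of_nonneg _ _ ha]
          ring
  · refine le_trans ?_ le_add_self
    calc ∫⁻ w in Metric.closedBall 0 r, truncSing 1 a (x - w) ∂μ
        ≤ ∫⁻ w in Metric.closedBall 0 r, truncSing (3 * r) a (x - w) ∂μ := by
          refine setLIntegral_mono' hmeas fun w hw => (truncSing_le _ _ _).trans ?_
          have hw' : ‖w‖ ≤ r := by simpa using hw
          rw [truncSing_of_norm_le a (by linarith [norm_sub_le x w])]
      _ ≤ ∫⁻ w, truncSing (3 * r) a (x - w) ∂μ := setLIntegral_le_lintegral _ _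
      _ = ∫⁻ w, truncSing (3 * r) a w ∂μ := lintegral_sub_left_eq_self _ x
      _ ≤ _ := by
          rw [lintegral_truncSing_eq μ (by linarith) ha, mul_pow,
            ENNReal.ofReal_mul (by positivity)]
          have : ((ENNReal.ofReal (3 * r))⁻¹) ^ a ≤ (‖x‖ₑ⁻¹) ^ a := by
            gcongr
            rw [← ofReal_norm]
            exact ENNReal.ofReal_le_ofReal (by linarith)
          calc _ = ENNReal.ofReal (3 ^ Module.finrank ℝ E) * (∫⁻ x : E, truncSing 1 a x ∂μ) *
                ENNReal.ofReal (r ^ Module.finrank ℝ E) * ((ENNReal.ofReal (3 * r))⁻¹) ^ a := by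
                ring
            _ ≤ _ := by gcongr

lemma exists_lintegral_truncSing_mul_indicator_le [Nontrivial E] {a : ℝ} (ha : 0 ≤ a)
    (had : a < Module.finrank ℝ E) (M : ℝ) :
    ∃ C : ℝ≥0∞, C ≠ ∞ ∧ ∀ r : ℝ, 0 < r → r ≤ M → ∀ (c : ℝ≥0∞) (x s : E),
      ∫⁻ u, truncSing 1 a (x - u) *
          (Metric.closedBall (0 : E) r).indicator (fun _ => c) (u - s) ∂μ ≤
        C * (c * ENNReal.ofReal (r ^ Module.finrank ℝ E)) * truncSing (1 + M) a (x - s) := by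
  obtain ⟨C, hC, h⟩ := exists_lintegral_truncSing_sub_le μ ha had M
  refine ⟨C, hC, fun r hr hrM c x s => ?_⟩
  have hmeas : MeasurableSet (Metric.closedBall (0 : E) r) :=
    Metric.isClosed_closedBall.measurableSet
  have hshift := lintegral_sub_right_eq_self (μ := μ) (fun w => truncSing 1 a (x - s - w) *
    (Metric.closedBall (0 : E) r).indicator (fun _ => c) w) s
  simp only [sub_sub_sub_cancel_right] at hshift
  rw [hshift]
  calc _ = ∫⁻ w in Metric.closedBall 0 r, truncSing 1 a (x - s - w) * c ∂μ := by
        rw [← lintegral_indicator hmeas]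
        congr 1 with w
        by_cases hw : w ∈ Metric.closedBall (0 : E) r <;> simp [hw]
    _ = (∫⁻ w in Metric.closedBall 0 r, truncSing 1 a (x - s - w) ∂μ) * c :=
        lintegral_mul_const _ (by fun_prop)
    _ ≤ C * ENNReal.ofReal (r ^ Module.finrank ℝ E) * truncSing (1 + M) a (x - s) * c := by
        gcongr
        exact h r hr hrM _
    _ = _ := by ring

/-- The convolution of two truncated singularities of order `a`. -/
lemma exists_lintegral_truncSing_mul_le [Nontrivial E] {R a p q : ℝ} (hR : 1 ≤ R) (hp : 0 ≤ p) (hpa : p ≤ a)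
    (hpq : p ≤ q) (had : 2 * a - p < Module.finrank ℝ E) :
    ∃ C : ℝ≥0∞, C ≠ ∞ ∧ ∀ v w : E,
      ∫⁻ y, truncSing R a (v - y) * truncSing R a (w - y) ∂μ ≤ C * (‖v - w‖ₑ⁻¹) ^ q := by
  refine ⟨(ENNReal.ofReal R ^ (q - p) * 2 ^ q) * (2 * ∫⁻ y : E, truncSing R (2 * a - p) y ∂μ),
    ?_, fun v w => ?_⟩
  · refine ENNReal.mul_ne_top (ENNReal.mul_ne_top ?_ ?_) (ENNReal.mul_ne_top (by simp) ?_)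
    · exact ENNReal.rpow_ne_top_of_nonneg (by linarith) (by simp)
    · exact ENNReal.rpow_ne_top_of_nonneg (by linarith) (by simp)
    · exact (lintegral_truncSing_lt_top μ R had).ne
  calc ∫⁻ y, truncSing R a (v - y) * truncSing R a (w - y) ∂μ
      ≤ ∫⁻ y, (ENNReal.ofReal R ^ (q - p) * 2 ^ q) * (‖v - w‖ₑ⁻¹) ^ q *
        (truncSing R (2 * a - p) (v - y) + truncSing R (2 * a - p) (w - y)) ∂μ := by
        refine lintegral_mono fun y => ?_
        simpa using truncSing_mul_le hR hp hpa hpq (v - y) (w - y)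
    _ = _ := by
        rw [lintegral_const_mul _ (by fun_prop), lintegral_add_left (by fun_prop),
          lintegral_sub_left_eq_self, lintegral_sub_left_eq_self]
        ring

end TruncatedSingularity

section CovarianceKernel

lemma pnorm_nonneg (z : ℝ × EuclideanSpace ℝ (Fin 3)) : 0 ≤ pnorm z := by
  unfold pnorm; positivity

lemma enorm_fst_rpow_le_pnorm (z : ℝ × EuclideanSpace ℝ (Fin 3)) :
    ‖z.1‖ₑ ^ ((1 : ℝ) / 2) ≤ ENNReal.ofReal (pnorm z) := by
  rw [← ofReal_norm, ENNReal.ofReal_rpow_of_nonneg (norm_nonneg _) (by norm_num)]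
  exact ENNReal.ofReal_le_ofReal (by unfold pnorm; simp)

lemma enorm_snd_le_pnorm (z : ℝ × EuclideanSpace ℝ (Fin 3)) :
    ‖z.2‖ₑ ≤ ENNReal.ofReal (pnorm z) := by
  rw [← ofReal_norm]
  exact ENNReal.ofReal_le_ofReal (by unfold pnorm; simp; positivity)

lemma enorm_kernel_le {K : ℝ × EuclideanSpace ℝ (Fin 3) → ℝ} {CK : ℝ}
    (hK : ∀ z, |K z| ≤ CK * pnorm z ^ (-3 : ℝ)) (hKsupp : ∀ z, 1 < pnorm z → K z = 0)
    {a b : ℝ} (ha : 0 ≤ a) (hb : 0 ≤ b) (hab : 2 * a + b = 3)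
    (z : ℝ × EuclideanSpace ℝ (Fin 3)) :
    ‖K z‖ₑ ≤ ENNReal.ofReal CK * (truncSing 1 a z.1 * truncSing 1 b z.2) := by
  rcases lt_or_ge 1 (pnorm z) with hz | hz
  · simp [hKsupp z hz]
  have h1 : ‖z.1‖ ≤ 1 := by
    have : |z.1| ^ ((1 : ℝ) / 2) ≤ 1 := le_trans (by unfold pnorm; simp) hz
    by_contra! h
    exact absurd this (not_le.2 (Real.one_lt_rpow h (by norm_num)))
  have h2 : ‖z.2‖ ≤ 1 := le_trans (by unfold pnorm; simp; positivity) hz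
  rw [truncSing_of_norm_le a h1, truncSing_of_norm_le b h2]
  calc ‖K z‖ₑ = ENNReal.ofReal |K z| := (Real.enorm_eq_ofReal_abs _)
    _ ≤ ENNReal.ofReal (CK * pnorm z ^ (-3 : ℝ)) := ENNReal.ofReal_le_ofReal (hK z)
    _ = ENNReal.ofReal CK * ENNReal.ofReal (pnorm z ^ (-3 : ℝ)) :=
        ENNReal.ofReal_mul' (Real.rpow_nonneg (pnorm_nonneg z) _)
    _ ≤ ENNReal.ofReal CK * (ENNReal.ofReal (pnorm z))⁻¹ ^ (2 * a + b) := by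
        gcongr
        rcases (pnorm_nonneg z).eq_or_lt with h0 | h0
        · rw [← h0, Real.zero_rpow (by norm_num)]; simp
        · rw [hab, ← ENNReal.ofReal_rpow_of_pos h0, ENNReal.rpow_neg, ENNReal.inv_rpow]
    _ = ENNReal.ofReal CK * (((ENNReal.ofReal (pnorm z))⁻¹) ^ (2 * a) *
          (ENNReal.ofReal (pnorm z))⁻¹ ^ b) := by
        rw [ENNReal.rpow_add_of_nonneg _ _ (by linarith) hb]
    _ ≤ ENNReal.ofReal CK * (((‖z.1‖ₑ ^ ((1 : ℝ) / 2))⁻¹) ^ (2 * a) * (‖z.2‖ₑ⁻¹) ^ b) := by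
        gcongr
        · exact enorm_fst_rpow_le_pnorm z
        · exact enorm_snd_le_pnorm z
    _ = _ := by
        rw [← ENNReal.inv_rpow, ← ENNReal.rpow_mul]
        congr 4; ring

/-- The time weight of the block average vanishes off the scale `ϑ` of the grid. -/
lemma block_integral_eq_zero {ρ₁ : ℝ → ℝ} {M C₀ ε ϑ : ℝ} (hM : 0 < M)
    (hρ₁M : ∀ t, M < |t| → ρ₁ t = 0) (hε : 0 < ε) (hϑ : 0 < ϑ) (hεϑ : ε ^ 2 ≤ C₀ * ϑ)
    {u s : ℝ} (hus : (1 + M * C₀) * ϑ < |u - s|) :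
    ∫ u₁ in ((⌊u / ϑ⌋ : ℝ) * ϑ)..(((⌊u / ϑ⌋ : ℝ) + 1) * ϑ),
      ε ^ (-2 : ℝ) * ρ₁ ((u₁ - s) / ε ^ 2) = 0 := by
  have h1 : (⌊u / ϑ⌋ : ℝ) * ϑ ≤ u := by
    have := Int.floor_le (u / ϑ)
    rwa [le_div_iff₀ hϑ] at this
  have h2 : u < ((⌊u / ϑ⌋ : ℝ) + 1) * ϑ := by
    have := Int.lt_floor_add_one (u / ϑ)
    rwa [div_lt_iff₀ hϑ] at this
  rw [intervalIntegral.integral_congr (g := fun _ => 0), intervalIntegral.integral_zero]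
  intro v hv
  rw [Set.uIcc_of_le (h1.trans h2.le)] at hv
  have huv : |u - v| ≤ ϑ := by
    rw [abs_le]; constructor <;> nlinarith [hv.1, hv.2]
  have hvs : M * ε ^ 2 < |v - s| := by
    have h3 : |u - s| ≤ |u - v| + |v - s| := abs_sub_le _ _ _
    nlinarith [mul_le_mul_of_nonneg_left hεϑ hM.le]
  have : ρ₁ ((v - s) / ε ^ 2) = 0 := by
    apply hρ₁M
    rw [abs_div, abs_of_pos (by positivity : 0 < ε ^ 2), lt_div_iff₀ (by positivity)]
    exact hvs
  simp [this]

lemma abs_block_integral_le {ρ₁ : ℝ → ℝ} (hρ₁ : Integrable ρ₁) {ε l r : ℝ} (hε : 0 < ε)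
    (hlr : l ≤ r) (s : ℝ) :
    |∫ u₁ in l..r, ε ^ (-2 : ℝ) * ρ₁ ((u₁ - s) / ε ^ 2)| ≤ ∫ t, |ρ₁ t| := by
  have hint : Integrable (fun u₁ : ℝ => |ε ^ (-2 : ℝ) * ρ₁ ((u₁ - s) / ε ^ 2)|) :=
    (((hρ₁.comp_div (by positivity : ε ^ 2 ≠ 0)).comp_sub_right s).const_mul _).abs
  calc _ ≤ ∫ u₁ in l..r, |ε ^ (-2 : ℝ) * ρ₁ ((u₁ - s) / ε ^ 2)| :=
        intervalIntegral.abs_integral_le_integral_abs hlr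
    _ ≤ ∫ u₁, |ε ^ (-2 : ℝ) * ρ₁ ((u₁ - s) / ε ^ 2)| := by
        rw [intervalIntegral.integral_of_le hlr]
        exact setIntegral_le_integral hint (.of_forall fun _ => abs_nonneg _)
    _ = ∫ t, |ρ₁ t| := by
        have h1 := integral_sub_right_eq_self (μ := (volume : Measure ℝ))
          (fun u₁ => |ρ₁ (u₁ / ε ^ 2)|) s
        have h2 := Measure.integral_comp_div (fun t => |ρ₁ t|) (ε ^ 2)
        simp only [abs_mul]
        rw [integral_const_mul, h1, h2, abs_of_pos (by positivity), smul_eq_mul, ← mul_assoc,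
          abs_of_pos (by positivity), Real.rpow_neg hε.le]
        norm_cast
        rw [inv_mul_cancel₀ (by positivity), one_mul]

lemma exists_forall_eq_zero_of_lt_norm {E : Type*} [NormedAddCommGroup E] {f : E → ℝ}
    (hf : HasCompactSupport f) : ∃ M : ℝ, 0 < M ∧ ∀ x, M < ‖x‖ → f x = 0 := by
  obtain ⟨M, hM, hfM⟩ := hf.isCompact.isBounded.exists_pos_norm_le
  refine ⟨M, hM, fun x hx => ?_⟩
  by_contra h
  exact absurd (hfM x (subset_tsupport f h)) (not_le.2 hx)

lemma exists_enorm_Kem_le {K : ℝ × EuclideanSpace ℝ (Fin 3) → ℝ} {CK : ℝ}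
    (hK : ∀ z, |K z| ≤ CK * pnorm z ^ (-3 : ℝ)) (hKsupp : ∀ z, 1 < pnorm z → K z = 0)
    {ρ₁ : ℝ → ℝ} (hρ₁ : Continuous ρ₁) (hρ₁s : HasCompactSupport ρ₁)
    {ρ₂ : EuclideanSpace ℝ (Fin 3) → ℝ} (hρ₂ : Continuous ρ₂) (hρ₂s : HasCompactSupport ρ₂)
    {C₀ : ℝ} (hC₀ : 0 < C₀) :
    ∃ R : ℝ, 1 ≤ R ∧ ∀ a b : ℝ, 0 ≤ a → a < 1 → 0 ≤ b → b < 3 → 2 * a + b = 3 →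
      ∃ C : ℝ≥0∞, C ≠ ∞ ∧ ∀ ε ∈ Set.Ioc (0 : ℝ) 1, ∀ ϑ ∈ Set.Ioc (0 : ℝ) 1,
        ε ^ 2 ≤ C₀ * ϑ → ∀ z z₂ : ℝ × EuclideanSpace ℝ (Fin 3),
          ‖Kem K ρ₁ ρ₂ ε ϑ z z₂‖ₑ ≤
            C * (truncSing R a (z.1 - z₂.1) * truncSing R b (z.2 - z₂.2)) := by
  obtain ⟨M₁, hM₁, hρ₁M⟩ := exists_forall_eq_zero_of_lt_norm hρ₁s
  obtain ⟨M₂, hM₂, hρ₂M⟩ := exists_forall_eq_zero_of_lt_norm hρ₂s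
  obtain ⟨B, hB⟩ := hρ₂s.exists_bound_of_continuous hρ₂
  set k := 1 + M₁ * C₀ with hk
  have hk0 : 0 < k := by positivity
  set L := ∫ t, |ρ₁ t| with hL
  have hL0 : 0 ≤ L := integral_nonneg fun _ => abs_nonneg _
  have hB0 : 0 ≤ B := (norm_nonneg _).trans (hB 0)
  refine ⟨1 + (k + M₂), by linarith, fun a b ha ha1 hb hb3 hab => ?_⟩
  obtain ⟨C₁, hC₁, h₁⟩ := exists_lintegral_truncSing_mul_indicator_le (volume : Measure ℝ) ha
    (by simpa using ha1) (k + M₂)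
  obtain ⟨C₂, hC₂, h₂⟩ := exists_lintegral_truncSing_mul_indicator_le
    (volume : Measure (EuclideanSpace ℝ (Fin 3))) hb (by simpa using hb3) (k + M₂)
  refine ⟨ENNReal.ofReal CK * (C₁ * ENNReal.ofReal (L * k)) *
    (C₂ * ENNReal.ofReal (B * M₂ ^ 3)), ?_, ?_⟩
  · exact ENNReal.mul_ne_top (ENNReal.mul_ne_top (by simp) (ENNReal.mul_ne_top hC₁ (by simp)))
      (ENNReal.mul_ne_top hC₂ (by simp))
  rintro ε ⟨hε, hε1⟩ ϑ ⟨hϑ, hϑ1⟩ hεϑ z z₂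
  set W₁ : ℝ → ℝ≥0∞ :=
    (Metric.closedBall (0 : ℝ) (k * ϑ)).indicator fun _ => ENNReal.ofReal (L / ϑ) with hW₁
  set W₂ : EuclideanSpace ℝ (Fin 3) → ℝ≥0∞ :=
    (Metric.closedBall (0 : EuclideanSpace ℝ (Fin 3)) (M₂ * ε)).indicator
      fun _ => ENNReal.ofReal (ε ^ (-3 : ℝ) * B) with hW₂
  have hW₁m : Measurable W₁ :=
    measurable_const.indicator Metric.isClosed_closedBall.measurableSet
  have hW₂m : Measurable W₂ :=
    measurable_const.indicator Metric.isClosed_closedBall.measurableSet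
  have htime : ∀ u : ℝ, ‖(1 / ϑ) * ∫ u₁ in ((⌊u / ϑ⌋ : ℝ) * ϑ)..(((⌊u / ϑ⌋ : ℝ) + 1) * ϑ),
      ε ^ (-2 : ℝ) * ρ₁ ((u₁ - z₂.1) / ε ^ 2)‖ₑ ≤ W₁ (u - z₂.1) := by
    intro u
    rcases lt_or_ge (k * ϑ) |u - z₂.1| with hu | hu
    · rw [block_integral_eq_zero hM₁ hρ₁M hε hϑ hεϑ hu]; simp
    · rw [hW₁, Set.indicator_of_mem (by simpa using hu), Real.enorm_eq_ofReal_abs]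
      refine ENNReal.ofReal_le_ofReal ?_
      rw [abs_mul, abs_of_pos (by positivity : 0 < 1 / ϑ), one_div,
        div_eq_inv_mul L]
      gcongr
      exact abs_block_integral_le (hρ₁.integrable_of_hasCompactSupport hρ₁s) hε
        (by nlinarith) _
  have hspace : ∀ y : EuclideanSpace ℝ (Fin 3),
      ‖ε ^ (-3 : ℝ) * ρ₂ (ε⁻¹ • (y - z₂.2))‖ₑ ≤ W₂ (y - z₂.2) := by
    intro y
    rcases lt_or_ge (M₂ * ε) ‖y - z₂.2‖ with hy | hy
    · rw [hρ₂M]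
      · simp
      · rwa [norm_smul, norm_inv, Real.norm_of_nonneg hε.le, ← div_eq_inv_mul,
          lt_div_iff₀ hε]
    · rw [hW₂, Set.indicator_of_mem (by simpa using hy), Real.enorm_eq_ofReal_abs]
      refine ENNReal.ofReal_le_ofReal ?_
      rw [abs_mul, abs_of_pos (by positivity)]
      gcongr
      exact hB _
  have hLk : ENNReal.ofReal (L / ϑ) * ENNReal.ofReal (k * ϑ) = ENNReal.ofReal (L * k) := by
    rw [← ENNReal.ofReal_mul (by positivity)]; congr 1; field_simp
  have hBM : ENNReal.ofReal (ε ^ (-3 : ℝ) * B) * ENNReal.ofReal ((M₂ * ε) ^ 3) =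
      ENNReal.ofReal (B * M₂ ^ 3) := by
    rw [← ENNReal.ofReal_mul (by positivity), Real.rpow_neg hε.le]
    congr 1; norm_cast; field_simp
  have h₁' := h₁ (k * ϑ) (by positivity) (by nlinarith) (ENNReal.ofReal (L / ϑ)) z.1 z₂.1
  have h₂' := h₂ (M₂ * ε) (by positivity) (by nlinarith) (ENNReal.ofReal (ε ^ (-3 : ℝ) * B))
    z.2 z₂.2
  rw [Module.finrank_self, pow_one, hLk] at h₁'
  rw [finrank_euclideanSpace_fin, hBM] at h₂'
  calc ‖Kem K ρ₁ ρ₂ ε ϑ z z₂‖ₑ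
      ≤ ∫⁻ u : ℝ, ∫⁻ y₁ : EuclideanSpace ℝ (Fin 3),
        (ENNReal.ofReal CK * (truncSing 1 a (z.1 - u) * W₁ (u - z₂.1))) *
          (truncSing 1 b (z.2 - y₁) * W₂ (y₁ - z₂.2)) := by
        refine (enorm_integral_le_lintegral_enorm _).trans (lintegral_mono fun u => ?_)
        refine (enorm_integral_le_lintegral_enorm _).trans (lintegral_mono fun y₁ => ?_)
        rw [intervalIntegral.integral_mul_const, ← mul_assoc (1 / ϑ), enorm_mul, enorm_mul]
        refine (mul_le_mul' (enorm_kernel_le hK hKsupp ha hb hab _)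
          (mul_le_mul' (htime u) (hspace y₁))).trans_eq ?_
        ring
    _ = ENNReal.ofReal CK * (∫⁻ u : ℝ, truncSing 1 a (z.1 - u) * W₁ (u - z₂.1)) *
          ∫⁻ y₁ : EuclideanSpace ℝ (Fin 3), truncSing 1 b (z.2 - y₁) * W₂ (y₁ - z₂.2) := by
        have hm₂ : Measurable fun y₁ : EuclideanSpace ℝ (Fin 3) =>
            truncSing 1 b (z.2 - y₁) * W₂ (y₁ - z₂.2) := by fun_prop
        have hm₁ : Measurable fun u : ℝ => truncSing 1 a (z.1 - u) * W₁ (u - z₂.1) := by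
          fun_prop
        simp_rw [lintegral_const_mul _ hm₂]
        rw [lintegral_mul_const _ (by fun_prop), lintegral_const_mul _ hm₁]
    _ ≤ _ := mul_le_mul' (mul_le_mul_right h₁' _) h₂'
    _ = _ := by ring

lemma exists_enorm_fcov_le {K : ℝ × EuclideanSpace ℝ (Fin 3) → ℝ} {CK : ℝ}
    (hK : ∀ z, |K z| ≤ CK * pnorm z ^ (-3 : ℝ)) (hKsupp : ∀ z, 1 < pnorm z → K z = 0)
    {ρ₁ : ℝ → ℝ} (hρ₁ : Continuous ρ₁) (hρ₁s : HasCompactSupport ρ₁)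
    {ρ₂ : EuclideanSpace ℝ (Fin 3) → ℝ} (hρ₂ : Continuous ρ₂) (hρ₂s : HasCompactSupport ρ₂)
    {C₀ : ℝ} (hC₀ : 0 < C₀) {a b p₁ q₁ p₂ q₂ : ℝ} (ha1 : a < 1) (hb3 : b < 3)
    (hab : 2 * a + b = 3) (hp₁ : 0 ≤ p₁) (hpa : p₁ ≤ a) (hpq₁ : p₁ ≤ q₁)
    (had : 2 * a - p₁ < 1) (hp₂ : 0 ≤ p₂) (hpb : p₂ ≤ b) (hpq₂ : p₂ ≤ q₂)
    (hbd : 2 * b - p₂ < 3) :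
    ∃ C : ℝ≥0∞, C ≠ ∞ ∧ ∀ ε ∈ Set.Ioc (0 : ℝ) 1, ∀ ϑ ∈ Set.Ioc (0 : ℝ) 1,
      ε ^ 2 ≤ C₀ * ϑ → ∀ z zb : ℝ × EuclideanSpace ℝ (Fin 3),
        ‖fcov K ρ₁ ρ₂ ε ϑ z zb‖ₑ ≤
          C * ((‖z.1 - zb.1‖ₑ⁻¹) ^ q₁ * (‖z.2 - zb.2‖ₑ⁻¹) ^ q₂) := by
  obtain ⟨R, hR, hKem⟩ := exists_enorm_Kem_le hK hKsupp hρ₁ hρ₁s hρ₂ hρ₂s hC₀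
  obtain ⟨C, hC, hKem⟩ := hKem a b (hp₁.trans hpa) ha1 (hp₂.trans hpb) hb3 hab
  obtain ⟨C₁, hC₁, h₁⟩ := exists_lintegral_truncSing_mul_le (volume : Measure ℝ) hR hp₁ hpa hpq₁
    (by simpa using had)
  obtain ⟨C₂, hC₂, h₂⟩ := exists_lintegral_truncSing_mul_le
    (volume : Measure (EuclideanSpace ℝ (Fin 3))) hR hp₂ hpb hpq₂ (by simpa using hbd)
  refine ⟨C * C * (C₁ * C₂), ENNReal.mul_ne_top (ENNReal.mul_ne_top hC hC)
    (ENNReal.mul_ne_top hC₁ hC₂), fun ε hε ϑ hϑ hεϑ z zb => ?_⟩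
  calc ‖fcov K ρ₁ ρ₂ ε ϑ z zb‖ₑ
      ≤ ∫⁻ w : ℝ × EuclideanSpace ℝ (Fin 3), C * C *
        ((truncSing R a (z.1 - w.1) * truncSing R a (zb.1 - w.1)) *
          (truncSing R b (z.2 - w.2) * truncSing R b (zb.2 - w.2))) := by
        refine (enorm_integral_le_lintegral_enorm _).trans (lintegral_mono fun w => ?_)
        rw [enorm_mul]
        refine (mul_le_mul' (hKem ε hε ϑ hϑ hεϑ z w) (hKem ε hε ϑ hϑ hεϑ zb w)).trans_eq ?_
        ring
    _ = C * C * ((∫⁻ s, truncSing R a (z.1 - s) * truncSing R a (zb.1 - s)) *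
          ∫⁻ y, truncSing R b (z.2 - y) * truncSing R b (zb.2 - y)) := by
        rw [lintegral_const_mul' _ _ (ENNReal.mul_ne_top hC hC), Measure.volume_eq_prod,
          lintegral_prod_mul (f := fun s => truncSing R a (z.1 - s) * truncSing R a (zb.1 - s))
            (g := fun y => truncSing R b (z.2 - y) * truncSing R b (zb.2 - y))]
        · exact Measurable.aemeasurable (by fun_prop)
        · exact Measurable.aemeasurable (by fun_prop)
    _ ≤ C * C * ((C₁ * (‖z.1 - zb.1‖ₑ⁻¹) ^ q₁) * (C₂ * (‖z.2 - zb.2‖ₑ⁻¹) ^ q₂)) := by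
        gcongr
        · exact h₁ _ _
        · exact h₂ _ _
    _ = _ := by ring

end CovarianceKernel

theorem stmt12 (K : ℝ × EuclideanSpace ℝ (Fin 3) → ℝ) (CK : ℝ)
    (hK : ∀ z, |K z| ≤ CK * pnorm z ^ (-3 : ℝ))
    (hKsupp : ∀ z, 1 < pnorm z → K z = 0)
    (hKcausal : ∀ (t : ℝ) (x : EuclideanSpace ℝ (Fin 3)), t ≤ 0 → K (t, x) = 0)
    (ρ₁ : ℝ → ℝ) (hρ₁ : ContDiff ℝ (⊤ : ℕ∞) ρ₁) (hρ₁s : HasCompactSupport ρ₁)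
    (hρ₁i : (∫ t : ℝ, ρ₁ t) = 1)
    (ρ₂ : EuclideanSpace ℝ (Fin 3) → ℝ) (hρ₂ : ContDiff ℝ (⊤ : ℕ∞) ρ₂)
    (hρ₂s : HasCompactSupport ρ₂) (hρ₂i : (∫ x : EuclideanSpace ℝ (Fin 3), ρ₂ x) = 1)
    (C₀ : ℝ) (hC₀ : 0 < C₀) (δ : ℝ) (hδ : 0 < δ) :
    ∃ C : ℝ, ∀ ε ∈ Set.Ioc (0 : ℝ) 1, ∀ ϑ ∈ Set.Ioc (0 : ℝ) 1, ε ^ 2 ≤ C₀ * ϑ →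
      ∀ z zb : ℝ × EuclideanSpace ℝ (Fin 3), z ≠ zb →
        |fcov K ρ₁ ρ₂ ε ϑ z zb| ≤ C * pnorm (z - zb) ^ (-1 - δ) := by
  set δ' := min δ (1 / 2) with hδ'
  have hδ'0 : 0 < δ' := lt_min hδ (by norm_num)
  have hδ'1 : δ' ≤ 1 / 2 := min_le_right _ _
  have hδ'δ : δ' ≤ δ := min_le_left _ _
  obtain ⟨C₁, hC₁, h₁⟩ := exists_enorm_fcov_le hK hKsupp hρ₁.continuous hρ₁s hρ₂.continuous hρ₂s
    hC₀ (a := 3 / 4 + δ' / 8) (b := 3 / 2 - δ' / 4) (p₁ := (1 + δ') / 2) (q₁ := (1 + δ) / 2)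
    (p₂ := 0) (q₂ := 0) (by linarith) (by linarith) (by ring) (by linarith) (by linarith)
    (by linarith) (by linarith) le_rfl (by linarith) le_rfl (by linarith)
  obtain ⟨C₂, hC₂, h₂⟩ := exists_enorm_fcov_le hK hKsupp hρ₁.continuous hρ₁s hρ₂.continuous hρ₂s
    hC₀ (a := 1 / 2 - δ' / 8) (b := 2 + δ' / 4) (p₁ := 0) (q₁ := 0)
    (p₂ := 1 + δ') (q₂ := 1 + δ) (by linarith) (by linarith) (by ring) le_rfl (by linarith)
    le_rfl (by linarith) (by linarith) (by linarith) (by linarith) (by linarith)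
  have hC : (C₁ + C₂) * 2 ^ (1 + δ) ≠ ∞ := ENNReal.mul_ne_top (ENNReal.add_ne_top.2 ⟨hC₁, hC₂⟩)
    (ENNReal.rpow_ne_top_of_nonneg (by linarith) (by simp))
  refine ⟨((C₁ + C₂) * 2 ^ (1 + δ)).toReal, fun ε hε ϑ hϑ hεϑ z zb hz => ?_⟩
  have hD : 0 < pnorm (z - zb) := by
    refine (pnorm_nonneg _).lt_of_ne fun h => hz ?_
    have ht := enorm_fst_rpow_le_pnorm (z - zb)
    have hx := enorm_snd_le_pnorm (z - zb)
    rw [← h, ENNReal.ofReal_zero, nonpos_iff_eq_zero] at ht hx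
    rw [ENNReal.rpow_eq_zero_iff_of_pos (by norm_num), enorm_eq_zero] at ht
    exact sub_eq_zero.1 (Prod.ext ht (enorm_eq_zero.1 hx))
  have key : ‖fcov K ρ₁ ρ₂ ε ϑ z zb‖ₑ ≤
      (C₁ + C₂) * (2 * (ENNReal.ofReal (pnorm (z - zb)))⁻¹) ^ (1 + δ) := by
    have hsum : ENNReal.ofReal (pnorm (z - zb)) =
        ‖z.1 - zb.1‖ₑ ^ ((1 : ℝ) / 2) + ‖z.2 - zb.2‖ₑ := by
      rw [pnorm, ENNReal.ofReal_add (by positivity) (by positivity), ← ofReal_norm,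
        ENNReal.ofReal_rpow_of_nonneg (norm_nonneg _) (by norm_num), ofReal_norm]
      rfl
    rcases le_total ‖z.2 - zb.2‖ₑ (‖z.1 - zb.1‖ₑ ^ ((1 : ℝ) / 2)) with hle | hle
    · have h2 : ENNReal.ofReal (pnorm (z - zb)) ≤ 2 * ‖z.1 - zb.1‖ₑ ^ ((1 : ℝ) / 2) := by
        rw [hsum, two_mul]; gcongr
      calc _ ≤ _ := h₁ ε hε ϑ hϑ hεϑ z zb
        _ = C₁ * ((‖z.1 - zb.1‖ₑ ^ ((1 : ℝ) / 2))⁻¹) ^ (1 + δ) := by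
            rw [ENNReal.rpow_zero, mul_one, ← ENNReal.inv_rpow, ← ENNReal.rpow_mul]
            congr 2; ring
        _ ≤ _ := mul_le_mul' le_self_add (ENNReal.rpow_le_rpow
            (ENNReal.inv_le_two_mul_inv h2) (by linarith))
    · have h2 : ENNReal.ofReal (pnorm (z - zb)) ≤ 2 * ‖z.2 - zb.2‖ₑ := by
        rw [hsum, two_mul]; gcongr
      calc _ ≤ _ := h₂ ε hε ϑ hϑ hεϑ z zb
        _ = C₂ * (‖z.2 - zb.2‖ₑ⁻¹) ^ (1 + δ) := by
            rw [ENNReal.rpow_zero, one_mul]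
        _ ≤ _ := mul_le_mul' le_add_self (ENNReal.rpow_le_rpow
            (ENNReal.inv_le_two_mul_inv h2) (by linarith))
  have hpow : (ENNReal.ofReal (pnorm (z - zb)))⁻¹ ^ (1 + δ) =
      ENNReal.ofReal (pnorm (z - zb) ^ (-1 - δ)) := by
    rw [← ENNReal.ofReal_rpow_of_pos hD, ENNReal.inv_rpow, ← ENNReal.rpow_neg]
    congr 1; ring
  rw [ENNReal.mul_rpow_of_nonneg _ _ (by linarith), hpow, ← mul_assoc,
    ← ENNReal.ofReal_toReal hC, ← ENNReal.ofReal_mul ENNReal.toReal_nonneg,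
    Real.enorm_eq_ofReal_abs] at key
  exact (ENNReal.ofReal_le_ofReal_iff (by positivity)).1 key
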